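/- Let ω be a supermodular (convex) capacity on N = {1,…,n}, i.e. ω(A ∪ B) + ω(A ∩ B) ≥ ω(A) + ω(B) for all A, B ⊆ N. Then the Choquet integral is a concave function on the nonnegative orthant: for all u, v ∈ ℝ^n with nonnegative components and all λ ∈ [0,1], Choquet(λu + (1−λ)v, ω) ≥ λ·Choquet(u, ω) + (1−λ)·Choquet(v, ω). -/

import Mathlib

/-- The Choquet integral of the (componentwise nonnegative) cost vector `u` w.r.t. the
set function `ω`, using the sorting permutation `Tuple.sort u`. -/
noncomputable def Choquet {n : ℕ} (u : Fin n → ℝ) (ω : Finset (Fin n) → ℝ) : ℝ :=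
  ∑ j : Fin n,
    (u (Tuple.sort u j) -
      if 0 < (j : ℕ) then
        u (Tuple.sort u ⟨(j : ℕ) - 1, lt_of_le_of_lt (Nat.sub_le _ _) j.isLt⟩)
      else 0) *
    ω ((Finset.univ.filter fun i : Fin n => j ≤ i).image (Tuple.sort u))

/-- A (normalized) capacity on `{1,…,n}`. -/
def IsCapacity {n : ℕ} (ω : Finset (Fin n) → ℝ) : Prop :=
  ω ∅ = 0 ∧ ω Finset.univ = 1 ∧ ∀ A B : Finset (Fin n), A ⊆ B → ω A ≤ ω B

open Finset in
lemma chq_abel_range (b g : ℕ → ℝ) (n : ℕ) :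
    ∑ j ∈ range n, (b (j+1) - b j) * g j =
      ∑ j ∈ range n, b (j+1) * (g j - g (j+1)) + b n * g n - b 0 * g 0 := by
  induction n with
  | zero => simp
  | succ k ih => rw [sum_range_succ, sum_range_succ, ih]; ring

lemma chq_abel {n : ℕ} (a : Fin n → ℝ) (g : ℕ → ℝ) (hg : g n = 0) :
    ∑ j : Fin n, (a j - if 0 < (j : ℕ) then
        a ⟨(j : ℕ) - 1, lt_of_le_of_lt (Nat.sub_le _ _) j.isLt⟩ else 0) * g j =
      ∑ j : Fin n, a j * (g j - g (j+1)) := by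
  let b : ℕ → ℝ := fun k => if h : 0 < k ∧ k - 1 < n then a ⟨k-1, h.2⟩ else 0
  have h := chq_abel_range b g n
  have hb0 : b 0 = 0 := by simp [b]
  rw [hg, hb0, ← Fin.sum_univ_eq_sum_range (fun j => (b (j+1) - b j) * g j),
    ← Fin.sum_univ_eq_sum_range (fun j => b (j+1) * (g j - g (j+1)))] at h
  have h1 : ∀ j : Fin n, b (j+1) = a j := by
    intro j; simp [b]
  have h2 : ∀ j : Fin n, b j = if 0 < (j : ℕ) then
        a ⟨(j : ℕ) - 1, lt_of_le_of_lt (Nat.sub_le _ _) j.isLt⟩ else 0 := by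
    intro j
    have := lt_of_le_of_lt (Nat.sub_le (j:ℕ) 1) j.isLt
    by_cases hj : 0 < (j : ℕ)
    · simp only [b, hj, this, and_self, dif_pos, if_pos]
    · simp [b, hj]
  simp only [h1, h2] at h
  rw [h]; ring

/-- Upper sets of a permutation. -/
def chqT {n : ℕ} (σ : Equiv.Perm (Fin n)) (k : ℕ) : Finset (Fin n) :=
  (Finset.univ.filter fun i : Fin n => k ≤ (i : ℕ)).image σ

lemma mem_chqT {n : ℕ} (σ : Equiv.Perm (Fin n)) (k : ℕ) (i : Fin n) :
    σ i ∈ chqT σ k ↔ k ≤ (i : ℕ) := by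
  simp [chqT]

lemma chqT_top {n : ℕ} (σ : Equiv.Perm (Fin n)) : chqT σ n = ∅ := by
  ext x
  obtain ⟨i, rfl⟩ := σ.surjective x
  simp [mem_chqT]

lemma chqT_zero {n : ℕ} (σ : Equiv.Perm (Fin n)) : chqT σ 0 = Finset.univ := by
  ext x
  obtain ⟨i, rfl⟩ := σ.surjective x
  simp [mem_chqT]

lemma chqT_succ {n : ℕ} (σ : Equiv.Perm (Fin n)) (j : Fin n) :
    chqT σ j = insert (σ j) (chqT σ (j+1)) := by
  ext x
  obtain ⟨i, rfl⟩ := σ.surjective x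
  simp only [mem_chqT, Finset.mem_insert, EmbeddingLike.apply_eq_iff_eq, Fin.ext_iff]
  omega

lemma choquet_abel {n : ℕ} (u : Fin n → ℝ) (ω : Finset (Fin n) → ℝ) (h0 : ω ∅ = 0) :
    Choquet u ω = ∑ j : Fin n, u (Tuple.sort u j) *
      (ω (chqT (Tuple.sort u) j) - ω (chqT (Tuple.sort u) (j+1))) :=
  chq_abel (fun j => u (Tuple.sort u j)) (fun k => ω (chqT (Tuple.sort u) k))
    (by simp only [chqT_top, h0])

lemma choquet_mono {n : ℕ} (u : Fin n → ℝ) (hu : ∀ j, 0 ≤ u j) (ω ν : Finset (Fin n) → ℝ)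
    (h : ∀ A, ω A ≤ ν A) : Choquet u ω ≤ Choquet u ν := by
  unfold Choquet
  refine Finset.sum_le_sum fun j _ => mul_le_mul_of_nonneg_left (h _) ?_
  split_ifs with hj
  · exact sub_nonneg.2 (Tuple.monotone_sort u (Fin.le_def.2 (Nat.sub_le _ _)))
  · simpa using hu _

lemma choquet_additive {n : ℕ} (u p : Fin n → ℝ) :
    Choquet u (fun A => ∑ i ∈ A, p i) = ∑ i, u i * p i := by
  rw [choquet_abel _ _ (by simp), ← Equiv.sum_comp (Tuple.sort u) (fun i => u i * p i)]
  refine Finset.sum_congr rfl fun j _ => ?_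
  rw [chqT_succ, Finset.sum_insert (by simp [mem_chqT])]
  ring

lemma chq_core {n : ℕ} (ω : Finset (Fin n) → ℝ) (h0 : ω ∅ = 0)
    (hsup : ∀ A B : Finset (Fin n), ω A + ω B ≤ ω (A ∪ B) + ω (A ∩ B))
    (σ : Equiv.Perm (Fin n)) (p : Fin n → ℝ)
    (hp : ∀ j : Fin n, p (σ j) = ω (chqT σ j) - ω (chqT σ (j+1)))
    (A : Finset (Fin n)) : ω A ≤ ∑ i ∈ A, p i := by
  have key : ∀ k, k ≤ n → ω (A ∩ chqT σ k) ≤ ∑ i ∈ A ∩ chqT σ k, p i := by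
    intro k hk
    induction hk using Nat.decreasingInduction with
    | self => simp [chqT_top, h0]
    | of_succ k hk ih =>
      have hs := chqT_succ σ ⟨k, hk⟩
      have hpk := hp ⟨k, hk⟩
      have hn : σ ⟨k, hk⟩ ∉ chqT σ (k+1) := by simp [mem_chqT]
      simp only at hs hpk
      by_cases hA : σ ⟨k, hk⟩ ∈ A
      · have e : A ∩ chqT σ k = insert (σ ⟨k, hk⟩) (A ∩ chqT σ (k+1)) := by
          rw [hs, Finset.inter_insert_of_mem hA]
        have h := hsup (A ∩ chqT σ k) (chqT σ (k+1))
        have e1 : A ∩ chqT σ k ∪ chqT σ (k+1) = chqT σ k := by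
          rw [e, hs]; ext x; simp; tauto
        have e2 : A ∩ chqT σ k ∩ chqT σ (k+1) = A ∩ chqT σ (k+1) := by
          rw [hs]; ext x; simp; tauto
        rw [e1, e2] at h
        have e3 : ∑ i ∈ A ∩ chqT σ k, p i = p (σ ⟨k, hk⟩) + ∑ i ∈ A ∩ chqT σ (k+1), p i := by
          rw [e, Finset.sum_insert (by simp [hn])]
        linarith
      · have e : A ∩ chqT σ k = A ∩ chqT σ (k+1) := by
          rw [hs, Finset.inter_insert_of_notMem hA]
        rw [e]; exact ih
  simpa [chqT_zero] using key 0 (Nat.zero_le _)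

/-- The Choquet integral w.r.t. a supermodular (convex) capacity is a concave function
on the nonnegative orthant. -/
theorem choquet_supermodular_concave {n : ℕ} (ω : Finset (Fin n) → ℝ) (hω : IsCapacity ω)
    (hsup : ∀ A B : Finset (Fin n), ω A + ω B ≤ ω (A ∪ B) + ω (A ∩ B))
    (u v : Fin n → ℝ) (hu : ∀ j, 0 ≤ u j) (hv : ∀ j, 0 ≤ v j)
    (l : ℝ) (hl0 : 0 ≤ l) (hl1 : l ≤ 1) :
    l * Choquet u ω + (1 - l) * Choquet v ω ≤
      Choquet (fun j => l * u j + (1 - l) * v j) ω := by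
  set w : Fin n → ℝ := fun j => l * u j + (1 - l) * v j with hw
  let σ := Tuple.sort w
  let p : Fin n → ℝ := fun i => ω (chqT σ (σ.symm i)) - ω (chqT σ (σ.symm i + 1))
  have hp : ∀ j : Fin n, p (σ j) = ω (chqT σ j) - ω (chqT σ (j+1)) := by
    intro j; simp [p]
  have hcore := chq_core ω hω.1 hsup σ p hp
  have h1 := choquet_mono u hu ω _ hcore
  have h2 := choquet_mono v hv ω _ hcore
  rw [choquet_additive] at h1 h2
  have h3 : Choquet w ω = l * ∑ i, u i * p i + (1 - l) * ∑ i, v i * p i := by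
    have : Choquet w ω = ∑ i, w i * p i := by
      rw [choquet_abel _ _ hω.1, ← Equiv.sum_comp σ (fun i => w i * p i)]
      exact Finset.sum_congr rfl fun j _ => by rw [hp]
    rw [this, Finset.mul_sum, Finset.mul_sum, ← Finset.sum_add_distrib]
    exact Finset.sum_congr rfl fun j _ => by simp only [hw]; ring
  rw [h3]
  exact add_le_add (mul_le_mul_of_nonneg_left h1 hl0)
    (mul_le_mul_of_nonneg_left h2 (by linarith))
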